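/- If 0 < θ < 1, 0 < ρ < 1, and either θ + ρ < 1, or θ + ρ = 1 and t·r(t)·q(t) → ∞ as t → ∞, then I(t) → ∞ and consequently P_t → 1 as t → ∞. -/

import Mathlib

open Filter in
/-- A function that grows at least by a factor `l > 1` when a large argument is doubled, and is
bounded below by a positive constant on one dyadic block, tends to infinity. -/
theorem tendsto_atTop_of_mul_le_two_mul {h : ℝ → ℝ} {T m l : ℝ} (hT : 0 < T) (hm : 0 < m)
    (hl : 1 < l) (hblock : ∀ t, T ≤ t → t ≤ 2 * T → m ≤ h t)
    (hdouble : ∀ t, T ≤ t → l * h t ≤ h (2 * t)) : Tendsto h atTop atTop := by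
  have key : ∀ n : ℕ, ∀ s, T ≤ s → s ≤ 2 * T → l ^ n * m ≤ h (2 ^ n * s) := by
    intro n s hs hs2
    induction n with
    | zero => simpa using hblock s hs hs2
    | succ n ih =>
      have h1 : T ≤ 2 ^ n * s :=
        hs.trans (le_mul_of_one_le_left (hT.le.trans hs) (one_le_pow₀ one_le_two))
      calc l ^ (n + 1) * m = l * (l ^ n * m) := by ring
        _ ≤ l * h (2 ^ n * s) := by gcongr
        _ ≤ h (2 * (2 ^ n * s)) := hdouble _ h1
        _ = h (2 ^ (n + 1) * s) := by congr 1; ring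
  rw [tendsto_atTop]
  intro b
  obtain ⟨k, hk⟩ := pow_unbounded_of_one_lt (b / m) hl
  filter_upwards [eventually_ge_atTop (2 ^ k * T)] with t ht
  have h1 : 2 ^ k ≤ t / T := (le_div_iff₀ hT).2 ht
  obtain ⟨n, hn, hn'⟩ := exists_nat_pow_near
    ((one_le_pow₀ (one_le_two (α := ℝ))).trans h1) one_lt_two
  have hkn : k ≤ n := by
    have := (pow_lt_pow_iff_right₀ (one_lt_two (α := ℝ))).1 (h1.trans_lt hn')
    omega
  have hp : (0 : ℝ) < 2 ^ n := by positivity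
  have h2 := key n (t / 2 ^ n)
    (by rw [le_div_iff₀ hp, mul_comm]; exact (le_div_iff₀ hT).1 hn)
    (by rw [div_le_iff₀ hp]; have := (div_lt_iff₀ hT).1 hn'; rw [pow_succ] at this; linarith)
  rw [mul_div_cancel₀ _ hp.ne'] at h2
  calc b ≤ l ^ k * m := ((div_lt_iff₀ hm).1 hk).le
    _ ≤ l ^ n * m := by gcongr; exact hl.le
    _ ≤ h t := h2

open Filter in
/-- If `r` and `q` are positive, non-increasing and regularly varying with indices `-θ` and `-ρ`
where `θ + ρ < 1`, then `t * r t * q t` tends to infinity. -/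
theorem tendsto_mul_mul_atTop_of_regularlyVarying {θ ρ : ℝ} {r q : ℝ → ℝ} (hsum : θ + ρ < 1)
    (hrpos : ∀ t > (0 : ℝ), 0 < r t) (hqpos : ∀ t > (0 : ℝ), 0 < q t)
    (hranti : AntitoneOn r (Set.Ioi 0)) (hqanti : AntitoneOn q (Set.Ioi 0))
    (hrrv : Tendsto (fun t => r (2 * t) / r t) atTop (nhds (2 ^ (-θ))))
    (hqrv : Tendsto (fun t => q (2 * t) / q t) atTop (nhds (2 ^ (-ρ)))) :
    Tendsto (fun t => t * r t * q t) atTop atTop := by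
  have hlim : Tendsto (fun t => 2 * (r (2 * t) / r t) * (q (2 * t) / q t)) atTop
      (nhds (2 ^ (1 - θ - ρ))) := by
    have heq : (2 : ℝ) ^ (1 - θ - ρ) = 2 * 2 ^ (-θ) * 2 ^ (-ρ) := by
      rw [sub_eq_add_neg, sub_eq_add_neg, Real.rpow_add two_pos, Real.rpow_add two_pos,
        Real.rpow_one]
    rw [heq]
    exact (hrrv.const_mul 2).mul hqrv
  obtain ⟨l, hl1, hl⟩ := exists_between
    (Real.one_lt_rpow one_lt_two (by linarith : (0 : ℝ) < 1 - θ - ρ))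
  obtain ⟨S, hS⟩ := eventually_atTop.1 (hlim.eventually (lt_mem_nhds hl))
  set T := max S 1
  have hT : 0 < T := lt_max_of_lt_right one_pos
  have hr2 := hrpos (2 * T) (by positivity)
  have hq2 := hqpos (2 * T) (by positivity)
  refine tendsto_atTop_of_mul_le_two_mul hT (m := T * r (2 * T) * q (2 * T)) (by positivity) hl1
    (fun t ht ht' => ?_) (fun t ht => ?_)
  · have ht0 : 0 < t := hT.trans_le ht
    have h1 := hranti (Set.mem_Ioi.2 ht0) (Set.mem_Ioi.2 (by positivity)) ht'
    have h2 := hqanti (Set.mem_Ioi.2 ht0) (Set.mem_Ioi.2 (by positivity)) ht'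
    have := hrpos t ht0
    gcongr
  · have ht0 : 0 < t := hT.trans_le ht
    have hr := hrpos t ht0
    have hq := hqpos t ht0
    have h1 := hS t ((le_max_left _ _).trans ht)
    calc l * (t * r t * q t)
        ≤ 2 * (r (2 * t) / r t) * (q (2 * t) / q t) * (t * r t * q t) := by gcongr
      _ = 2 * t * r (2 * t) * q (2 * t) := by field_simp

open MeasureTheory in
theorem intervalIntegrable_comp_sub_mul_half {r q : ℝ → ℝ} {t : ℝ} (ht : 0 < t)
    (hrpos : ∀ t > (0 : ℝ), 0 < r t) (hranti : AntitoneOn r (Set.Ioi 0))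
    (hrint : IntervalIntegrable r volume 0 t) (hqint : IntervalIntegrable q volume 0 t) :
    IntervalIntegrable (fun u => r (t - u) * q u) volume 0 (t / 2) := by
  have hsub : Set.uIcc 0 (t / 2) ⊆ Set.uIcc 0 t := by
    rw [Set.uIcc_of_le (by positivity), Set.uIcc_of_le ht.le]
    exact Set.Icc_subset_Icc_right (by linarith)
  have hr : IntervalIntegrable (fun u => r (t - u)) volume 0 (t / 2) := by
    have := (hrint.comp_sub_left t).symm
    simp only [sub_self, sub_zero] at this
    exact this.mono_set hsub
  have hq := hqint.mono_set hsub
  rw [intervalIntegrable_iff_integrableOn_Ioc_of_le (by positivity)] at *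
  refine hq.bdd_mul (c := r (t / 2)) hr.aestronglyMeasurable ?_
  filter_upwards [ae_restrict_mem measurableSet_Ioc] with u hu
  have h0 : 0 < t - u := by linarith [hu.2]
  rw [Real.norm_of_nonneg (hrpos _ h0).le]
  exact hranti (Set.mem_Ioi.2 (by positivity)) (Set.mem_Ioi.2 h0) (by linarith [hu.2])

open MeasureTheory in
/-- The convolution integrand of two positive non-increasing functions, integrable near `0`, is
integrable. -/
theorem intervalIntegrable_comp_sub_mul {r q : ℝ → ℝ} {t : ℝ} (ht : 0 < t)
    (hrpos : ∀ t > (0 : ℝ), 0 < r t) (hqpos : ∀ t > (0 : ℝ), 0 < q t)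
    (hranti : AntitoneOn r (Set.Ioi 0)) (hqanti : AntitoneOn q (Set.Ioi 0))
    (hrint : IntervalIntegrable r volume 0 t) (hqint : IntervalIntegrable q volume 0 t) :
    IntervalIntegrable (fun u => r (t - u) * q u) volume 0 t := by
  refine (intervalIntegrable_comp_sub_mul_half ht hrpos hranti hrint hqint).trans ?_
  have h := ((intervalIntegrable_comp_sub_mul_half ht hqpos hqanti hqint hrint).comp_sub_left
    t).symm
  simp only [sub_sub_cancel, sub_zero, sub_half] at h
  simpa only [mul_comm] using h

open MeasureTheory in
/-- The convolution at `t` of two positive non-increasing functions is at least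
`t * r t * q t`. -/
theorem mul_mul_le_integral_comp_sub_mul {r q : ℝ → ℝ} {t : ℝ} (ht : 0 < t)
    (hrpos : ∀ t > (0 : ℝ), 0 < r t) (hqpos : ∀ t > (0 : ℝ), 0 < q t)
    (hranti : AntitoneOn r (Set.Ioi 0)) (hqanti : AntitoneOn q (Set.Ioi 0))
    (hrint : IntervalIntegrable r volume 0 t) (hqint : IntervalIntegrable q volume 0 t) :
    t * r t * q t ≤ ∫ u in (0 : ℝ)..t, r (t - u) * q u := by
  have hmono := intervalIntegral.integral_mono_on_of_le_Ioo ht.le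
    (intervalIntegrable_const (c := r t * q t))
    (intervalIntegrable_comp_sub_mul ht hrpos hqpos hranti hqanti hrint hqint) (fun u hu => ?_)
  · simpa [mul_assoc, mul_left_comm] using hmono
  · have h0 : 0 < t - u := sub_pos.2 hu.2
    have h1 := hranti (Set.mem_Ioi.2 h0) (Set.mem_Ioi.2 ht) (by linarith [hu.1])
    have h2 := hqanti (Set.mem_Ioi.2 hu.1) (Set.mem_Ioi.2 ht) hu.2.le
    exact mul_le_mul h1 h2 (hqpos t ht).le (hrpos _ h0).le


open Filter MeasureTheory Real in
theorem stmt8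
    (θ ρ : ℝ) (hθpos : 0 < θ) (hρpos : 0 < ρ)
    (r q : ℝ → ℝ)
    (hrpos : ∀ t > (0:ℝ), 0 < r t) (hqpos : ∀ t > (0:ℝ), 0 < q t)
    (hranti : AntitoneOn r (Set.Ioi 0)) (hqanti : AntitoneOn q (Set.Ioi 0))
    (hrint : ∀ t > (0:ℝ), MeasureTheory.IntegrableOn r (Set.Ioc 0 t))
    (hqint : ∀ t > (0:ℝ), MeasureTheory.IntegrableOn q (Set.Ioc 0 t))
    (hrrv : ∀ c > (0:ℝ), Filter.Tendsto (fun t => r (c * t) / r t) Filter.atTop (nhds (c ^ (-θ))))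
    (hqrv : ∀ c > (0:ℝ), Filter.Tendsto (fun t => q (c * t) / q t) Filter.atTop (nhds (c ^ (-ρ))))
    (R Q I P : ℝ → ℝ)
    (hR : ∀ t, R t = ∫ u in (0:ℝ)..t, r u)
    (hQ : ∀ t, Q t = ∫ u in (0:ℝ)..t, q u)
    (hI : ∀ t, I t = ∫ u in (0:ℝ)..t, r (t - u) * q u)
    (hP : ∀ t, P t = 1 - Real.exp (-(I t)))
    (hθ : θ < 1) (hρ : ρ < 1)
    (hcase : θ + ρ < 1 ∨ (θ + ρ = 1 ∧
      Filter.Tendsto (fun t => t * r t * q t) Filter.atTop Filter.atTop)) :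
    Filter.Tendsto I Filter.atTop Filter.atTop
    ∧ Filter.Tendsto P Filter.atTop (nhds 1) := by
  have hprod : Tendsto (fun t => t * r t * q t) atTop atTop := by
    rcases hcase with hlt | ⟨-, h⟩
    · exact tendsto_mul_mul_atTop_of_regularlyVarying hlt hrpos hqpos hranti hqanti
        (hrrv 2 two_pos) (hqrv 2 two_pos)
    · exact h
  have hItop : Tendsto I atTop atTop := by
    refine tendsto_atTop_mono' _ ?_ hprod
    filter_upwards [eventually_gt_atTop 0] with t ht
    rw [hI]
    exact mul_mul_le_integral_comp_sub_mul ht hrpos hqpos hranti hqanti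
      ((intervalIntegrable_iff_integrableOn_Ioc_of_le ht.le).2 (hrint t ht))
      ((intervalIntegrable_iff_integrableOn_Ioc_of_le ht.le).2 (hqint t ht))
  refine ⟨hItop, ?_⟩
  have hexp := (tendsto_exp_neg_atTop_nhds_zero.comp hItop).const_sub 1
  rw [sub_zero] at hexp
  exact hexp.congr fun t => (hP t).symm
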